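/- arXiv:1301.2795 — 2 statements merged into one kernel-verified Lean document; each statement's English description precedes it below -/
import Mathlib

section
/- Let h and q be odd integers with h, q ≥ 1, H = q·h, and let f : ℤ/hℤ → ℂ have zero mean (Σ_{j ∈ ℤ/hℤ} f(j) = 0). Let α = (α₀, …, α_{q−1}) be uniformly distributed on (ℤ/hℤ)^q, and set F_α = f ∘ φ_α. Then for every integer s with 1 ≤ s ≤ q − 1, E_α[ |RC_{F_α}(s·h)|² ] = (1/(q·h))·Σ_{d ∈ ℤ/hℤ} |RC_f(d)|². -/
/-- The cyclic correlation of `f : ℤ/hℤ → ℂ` at `t`: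
`RC_f(t) = (1/h)·Σ_{j ∈ ℤ/hℤ} f(j+t)·conj(f(j))`. -/
noncomputable def cyclicCorr (h : ℕ) [NeZero h] (f : ZMod h → ℂ) (t : ZMod h) : ℂ :=
  (h : ℂ)⁻¹ * ∑ j : ZMod h, f (j + t) * (starRingEnd ℂ) (f j)

/-- The projection `φ_α : ℤ/Hℤ → ℤ/hℤ` (for `H = q·h` and a tuple `α ∈ (ℤ/hℤ)^q`),
`φ_α(j·h + k) = k + α_j (mod h)` for `0 ≤ k < h`, `0 ≤ j < q`. -/
noncomputable def phiMap {m : ℕ} (h q : ℕ) (α : ZMod q → ZMod h) (x : ZMod m) : ZMod h :=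
  ((x.val % h : ℕ) : ZMod h) + α ((x.val / h : ℕ) : ZMod q)

open Finset in
lemma aux_avg {ι A : Type*} [Fintype ι] [DecidableEq ι] [Fintype A] [AddCommGroup A]
    (G : (ι → A) → ℂ) (i : ι) (C : ℂ)
    (hG : ∀ α : ι → A, ∑ a : A, G (α + Pi.single i a) = C) :
    (Fintype.card A : ℂ) * ∑ α, G α = (Fintype.card A : ℂ) ^ (Fintype.card ι) * C := by
  have h1 : ∀ a : A, ∑ α : ι → A, G (α + Pi.single i a) = ∑ α, G α := fun a =>
    Fintype.sum_equiv (Equiv.addRight (Pi.single i a)) _ _ (fun _ => rfl)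
  have h2 : ∑ a : A, ∑ α : ι → A, G (α + Pi.single i a) = (Fintype.card A : ℂ) * ∑ α, G α := by
    simp [h1]
  rw [← h2, Finset.sum_comm]
  simp [hG]

lemma aux_phi (h q : ℕ) [NeZero h] [NeZero q] (α : ZMod q → ZMod h) (n : ℕ) :
    phiMap h q α ((n : ℕ) : ZMod (q * h)) = (n : ZMod h) + α ((n / h : ℕ) : ZMod q) := by
  unfold phiMap
  rw [ZMod.val_natCast, Nat.mod_mul_left_mod, Nat.mod_mul_left_div_self]
  simp

lemma aux_split (h q : ℕ) [NeZero h] [NeZero q] (P : ZMod (q * h) → ℂ) :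
    ∑ x, P x = ∑ j : ZMod q, ∑ k : ZMod h, P ((j.val * h + k.val : ℕ) : ZMod (q * h)) := by
  rw [← Fintype.sum_prod_type']
  symm
  refine Fintype.sum_bijective
    (fun p : ZMod q × ZMod h => ((p.1.val * h + p.2.val : ℕ) : ZMod (q * h))) ?_ _ _ (fun _ => rfl)
  rw [Fintype.bijective_iff_injective_and_card]
  refine ⟨?_, by simp [ZMod.card]⟩
  have hlt : ∀ (a : ZMod q) (b : ZMod h), a.val * h + b.val < q * h := by
    intro a b
    have h1 := a.val_lt
    have h2 := b.val_lt
    nlinarith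
  have hpos : 0 < h := Nat.pos_of_ne_zero (NeZero.ne h)
  rintro ⟨a, b⟩ ⟨c, d⟩ he
  have he' : a.val * h + b.val = c.val * h + d.val := by
    have := congrArg ZMod.val he
    simp only [ZMod.val_natCast] at this
    rwa [Nat.mod_eq_of_lt (hlt a b), Nat.mod_eq_of_lt (hlt c d)] at this
  have hb : b.val = d.val := by
    have := congrArg (· % h) he'
    simpa [Nat.add_mod, Nat.mod_eq_of_lt b.val_lt, Nat.mod_eq_of_lt d.val_lt] using this
  have ha : a.val = c.val := by
    rw [hb] at he'
    exact Nat.eq_of_mul_eq_mul_right hpos (Nat.add_right_cancel he')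
  rw [ZMod.val_injective q ha, ZMod.val_injective h hb]

lemma aux_corr (h q : ℕ) [NeZero h] [NeZero q] (f : ZMod h → ℂ) (α : ZMod q → ZMod h) (s : ℕ) :
    cyclicCorr (q * h) (fun x => f (phiMap h q α x)) ((s * h : ℕ) : ZMod (q * h))
      = (q : ℂ)⁻¹ * ∑ j : ZMod q, cyclicCorr h f (α (j + s) - α j) := by
  have hpos : 0 < h := Nat.pos_of_ne_zero (NeZero.ne h)
  unfold cyclicCorr
  rw [aux_split, ← Finset.mul_sum, ← mul_assoc]
  congr 1
  · push_cast
    rw [mul_inv]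
  refine Finset.sum_congr rfl fun j _ => ?_
  refine Fintype.sum_equiv (Equiv.addRight (α j)) _ _ fun k => ?_
  have e1 : (j.val * h + k.val) / h = j.val := by
    rw [mul_comm, Nat.mul_add_div hpos, Nat.div_eq_of_lt k.val_lt, add_zero]
  have e2 : (j.val * h + k.val + s * h) / h = j.val + s := by
    rw [Nat.add_mul_div_right _ _ hpos, e1]
  rw [← Nat.cast_add]
  beta_reduce
  rw [aux_phi, aux_phi, e1, e2]
  simp

lemma aux_sum_zero (h : ℕ) [NeZero h] (f : ZMod h → ℂ) (hf : ∑ j : ZMod h, f j = 0) :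
    ∑ d, cyclicCorr h f d = 0 := by
  unfold cyclicCorr
  rw [← Finset.mul_sum, Finset.sum_comm]
  have : ∀ j : ZMod h, ∑ d, f (j + d) * (starRingEnd ℂ) (f j) = 0 := by
    intro j
    rw [← Finset.sum_mul, Fintype.sum_equiv (Equiv.addLeft j) (fun d => f (j + d)) f (fun _ => rfl),
      hf, zero_mul]
  simp [this]

lemma aux_off (h q : ℕ) [NeZero h] [NeZero q] (g : ZMod h → ℂ) (hg : ∑ d, g d = 0)
    (s : ZMod q) (hs : s ≠ 0) (hs2 : s + s ≠ 0) (i j : ZMod q) (hij : i ≠ j) :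
    ∑ α : ZMod q → ZMod h, g (α (i + s) - α i) * (starRingEnd ℂ) (g (α (j + s) - α j)) = 0 := by
  have hh : (Fintype.card (ZMod h) : ℂ) ≠ 0 := by simp [NeZero.ne h]
  have his : i + s ≠ i := by simpa using hs
  have hijs : i + s ≠ j + s := by simpa using hij
  by_cases hc : i = j + s
  · have hc' : i + s ≠ j := by
      rintro hc'
      apply hs2
      rw [hc, add_assoc] at hc'
      simpa using hc'
    have := aux_avg (fun α : ZMod q → ZMod h =>
      g (α (i + s) - α i) * (starRingEnd ℂ) (g (α (j + s) - α j))) (i + s) 0 (by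
        intro α
        simp only [Pi.add_apply, Pi.single_eq_same, Pi.single_eq_of_ne his.symm,
          Pi.single_eq_of_ne hijs.symm, Pi.single_eq_of_ne hc'.symm, add_zero]
        rw [← Finset.sum_mul, Fintype.sum_equiv (Equiv.addLeft (α (i + s) - α i)) _ g
          (fun a => by simp; congr 1; ring), hg, zero_mul])
    simpa [hh, NeZero.ne h] using this
  · have := aux_avg (fun α : ZMod q → ZMod h =>
      g (α (i + s) - α i) * (starRingEnd ℂ) (g (α (j + s) - α j))) i 0 (by
        intro α
        simp only [Pi.add_apply, Pi.single_eq_same, Pi.single_eq_of_ne his,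
          Pi.single_eq_of_ne hij.symm, Pi.single_eq_of_ne (Ne.symm hc), add_zero]
        rw [← Finset.sum_mul, Fintype.sum_equiv (Equiv.subLeft (α (i + s) - α i)) _ g
          (fun a => by simp; congr 1; ring), hg, zero_mul])
    simpa [hh, NeZero.ne h] using this

lemma aux_diag (h q : ℕ) [NeZero h] [NeZero q] (g : ZMod h → ℂ)
    (s : ZMod q) (hs : s ≠ 0) (i : ZMod q) :
    (h : ℂ) * ∑ α : ZMod q → ZMod h, g (α (i + s) - α i) * (starRingEnd ℂ) (g (α (i + s) - α i))
      = (h : ℂ) ^ q * ∑ d, g d * (starRingEnd ℂ) (g d) := by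
  have his : i + s ≠ i := by simpa using hs
  have := aux_avg (fun α : ZMod q → ZMod h =>
      g (α (i + s) - α i) * (starRingEnd ℂ) (g (α (i + s) - α i))) (i + s)
      (∑ d, g d * (starRingEnd ℂ) (g d)) (by
        intro α
        simp only [Pi.add_apply, Pi.single_eq_same, Pi.single_eq_of_ne his.symm, add_zero]
        exact Fintype.sum_equiv (Equiv.addLeft (α (i + s) - α i)) _ _
          (fun a => by
            have : α (i + s) + a - α i = α (i + s) - α i + a := by ring
            simp [this]))
  simpa [ZMod.card] using this

/-- Let `h, q` be odd, `f : ℤ/hℤ → ℂ` of zero mean, and `α` uniformly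
distributed on `(ℤ/hℤ)^q`.  Then for every integer `s` with `1 ≤ s ≤ q − 1`,
`E_α[ |RC_{F_α}(s·h)|² ] = (1/(q·h))·Σ_{d ∈ ℤ/hℤ} |RC_f(d)|²`. -/
theorem expectation_sq_cyclicCorr_comp_phiMap
    (h q : ℕ) [NeZero h] [NeZero q] (hodd : Odd h) (qodd : Odd q)
    (f : ZMod h → ℂ) (hf : ∑ j : ZMod h, f j = 0)
    (s : ℕ) (hs1 : 1 ≤ s) (hs2 : s ≤ q - 1) :
    ((h : ℝ) ^ q)⁻¹ *
        ∑ α : ZMod q → ZMod h,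
          ‖cyclicCorr (q * h) (fun x => f (phiMap h q α x)) ((s * h : ℕ) : ZMod (q * h))‖ ^ 2
      = ((q : ℝ) * h)⁻¹ * ∑ d : ZMod h, ‖cyclicCorr h f d‖ ^ 2 := by
  have hq0 : (q : ℂ) ≠ 0 := by exact_mod_cast NeZero.ne q
  have hh0 : (h : ℂ) ≠ 0 := by exact_mod_cast NeZero.ne h
  have hs : (s : ZMod q) ≠ 0 := by
    rw [Ne, ZMod.natCast_eq_zero_iff]
    intro hd
    have := Nat.le_of_dvd (by omega) hd
    omega
  have hss : (s : ZMod q) + s ≠ 0 := by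
    rw [← Nat.cast_add, Ne, ZMod.natCast_eq_zero_iff, ← two_mul]
    intro hd
    have hd' := (Nat.Coprime.dvd_mul_left (Nat.coprime_two_right.mpr qodd)).mp hd
    have := Nat.le_of_dvd (by omega) hd'
    omega
  have hn : ∀ z : ℂ, ((‖z‖ : ℂ)) ^ 2 = z * (starRingEnd ℂ) z := fun z =>
    (Complex.mul_conj' z).symm
  simp only [aux_corr]
  apply Complex.ofReal_injective
  push_cast
  simp only [hn]
  set g := cyclicCorr h f with hg
  have hg0 : ∑ d, g d = 0 := aux_sum_zero h f hf
  have key : ∑ α : ZMod q → ZMod h, ∑ i : ZMod q, ∑ j : ZMod q,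
      g (α (i + s) - α i) * (starRingEnd ℂ) (g (α (j + s) - α j))
      = (q : ℂ) * ((h : ℂ)⁻¹ * ((h : ℂ) ^ q * ∑ d, g d * (starRingEnd ℂ) (g d))) := by
    rw [Finset.sum_comm]
    have : ∀ i : ZMod q, ∑ α : ZMod q → ZMod h, ∑ j : ZMod q,
      g (α (i + s) - α i) * (starRingEnd ℂ) (g (α (j + s) - α j))
      = (h : ℂ)⁻¹ * ((h : ℂ) ^ q * ∑ d, g d * (starRingEnd ℂ) (g d)) := by
      intro i
      rw [Finset.sum_comm, Finset.sum_eq_single i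
        (fun j _ hj => aux_off h q g hg0 s hs hss i j hj.symm) (by simp),
        ← aux_diag h q g s hs i, inv_mul_cancel_left₀ hh0]
    simp [this, ZMod.card]
  have e : ∀ α : ZMod q → ZMod h,
      ((q : ℂ)⁻¹ * ∑ j : ZMod q, g (α (j + s) - α j)) *
        (starRingEnd ℂ) ((q : ℂ)⁻¹ * ∑ j : ZMod q, g (α (j + s) - α j))
      = ((q : ℂ)⁻¹ * (q : ℂ)⁻¹) * ∑ i : ZMod q, ∑ j : ZMod q,
        g (α (i + s) - α i) * (starRingEnd ℂ) (g (α (j + s) - α j)) := by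
    intro α
    rw [← Finset.sum_mul_sum, map_mul, map_sum, map_inv₀, Complex.conj_natCast]
    ring
  simp only [e]
  rw [← Finset.mul_sum, key]
  field_simp
end

section
/- Let h and q be odd integers with h, q ≥ 1, H = q·h, and let f : ℤ/hℤ → ℂ have zero mean (Σ_{j ∈ ℤ/hℤ} f(j) = 0). Let α = (α₀, …, α_{q−1}) be uniformly distributed on (ℤ/hℤ)^q, and set F_α = f ∘ φ_α. Then the expected squared ℓ²-norm of the cyclic correlation sequence at most doubles: E_α[ Σ_{t ∈ ℤ/Hℤ} |RC_{F_α}(t)|² ] ≤ 2·Σ_{d ∈ ℤ/hℤ} |RC_f(d)|². -/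
open Complex ComplexConjugate

lemma orth {N : ℕ} [NeZero N] {ι : Type*} [DecidableEq ι] (s : Finset ι) (c : ι → ℂ) (p : ι → ZMod N)
    (hp : Set.InjOn p s) :
    ∑ m : ZMod N, ‖∑ i ∈ s, c i * ZMod.stdAddChar (m * p i)‖ ^ 2 = N * ∑ i ∈ s, ‖c i‖ ^ 2 := by
  apply Complex.ofReal_injective
  push_cast
  simp_rw [← Complex.mul_conj', map_sum, Finset.sum_mul_sum, map_mul, ← AddChar.map_neg_eq_conj]
  rw [Finset.sum_comm, Finset.mul_sum]
  refine Finset.sum_congr rfl fun i hi => ?_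
  rw [Finset.sum_comm, Finset.sum_eq_single i]
  · simp_rw [mul_mul_mul_comm, ← AddChar.map_add_eq_mul]
    simp [ZMod.card]
  · intro j hj hji
    have : ∀ m : ZMod N, c i * ZMod.stdAddChar (m * p i) * (conj (c j) * ZMod.stdAddChar (-(m * p j)))
       = c i * conj (c j) * ZMod.stdAddChar (m * (p i - p j)) := by
      intro m
      rw [mul_mul_mul_comm, ← AddChar.map_add_eq_mul]; congr 2; ring
    simp_rw [this, ← Finset.mul_sum]
    rw [AddChar.sum_mulShift _ (ZMod.isPrimitive_stdAddChar N), if_neg, Nat.cast_zero, mul_zero]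
    rw [sub_eq_zero]
    exact fun h => hji (hp hj hi h.symm)
  · exact fun h => (h hi).elim

/-- cross-correlation Parseval -/
lemma parseval_cross {N : ℕ} [NeZero N] (f g : ZMod N → ℂ) :
    ∑ m : ZMod N, ‖∑ x, f x * ZMod.stdAddChar (m * x)‖ ^ 2 * ‖∑ x, g x * ZMod.stdAddChar (m * x)‖ ^ 2
     = N * ∑ t : ZMod N, ‖∑ x, f (x + t) * conj (g x)‖ ^ 2 := by
  rw [← orth Finset.univ _ id Function.injective_id.injOn]
  refine Finset.sum_congr rfl fun m _ => ?_
  have : (∑ x, f x * ZMod.stdAddChar (m * x)) * conj (∑ x, g x * ZMod.stdAddChar (m * x))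
     = ∑ i, (∑ x, f (x + i) * conj (g x)) * ZMod.stdAddChar (m * id i) := by
    simp_rw [map_sum, Finset.sum_mul_sum, map_mul, ← AddChar.map_neg_eq_conj, Finset.sum_mul]
    rw [Finset.sum_comm]
    conv_rhs => rw [Finset.sum_comm]
    refine Finset.sum_congr rfl fun y _ => ?_
    rw [← Equiv.sum_comp (Equiv.addLeft y)]
    refine Finset.sum_congr rfl fun t _ => ?_
    simp only [Equiv.coe_addLeft, id]
    rw [mul_mul_mul_comm, ← AddChar.map_add_eq_mul]; congr 2; ring
  rw [← this, norm_mul, mul_pow, RCLike.norm_conj]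

lemma two_moments {A B : Type*} [Fintype A] [Fintype B] (X : A → ℂ) (Y : B → ℂ)
    (hX : ∑ a, X a = 0) (hY : ∑ b, Y b = 0) :
    (∑ a, ∑ b, (X a + Y b) = 0) ∧
    (∑ a, ∑ b, (X a + Y b) * conj (X a + Y b) = Fintype.card B * (∑ a, X a * conj (X a))
      + Fintype.card A * ∑ b, Y b * conj (Y b)) ∧
    (∑ a, ∑ b, (X a + Y b) ^ 2 = Fintype.card B * (∑ a, X a ^ 2)
      + Fintype.card A * ∑ b, Y b ^ 2) ∧
    (∑ a, ∑ b, ((X a + Y b) * conj (X a + Y b)) ^ 2 = Fintype.card B * (∑ a, (X a * conj (X a)) ^ 2)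
      + (∑ a, X a ^ 2) * conj (∑ b, Y b ^ 2) + 4 * (∑ a, X a * conj (X a)) * (∑ b, Y b * conj (Y b))
      + conj (∑ a, X a ^ 2) * (∑ b, Y b ^ 2)
      + Fintype.card A * ∑ b, (Y b * conj (Y b)) ^ 2) := by
  have cX : ∑ a, conj (X a) = 0 := by rw [← map_sum, hX, map_zero]
  have cY : ∑ b, conj (Y b) = 0 := by rw [← map_sum, hY, map_zero]
  refine ⟨?_, ?_, ?_, ?_⟩
  · simp [Finset.sum_add_distrib, ← Finset.mul_sum, hX, hY]
  · have : ∀ a b, (X a + Y b) * conj (X a + Y b) =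
        X a * conj (X a) + X a * conj (Y b) + conj (X a) * Y b + Y b * conj (Y b) := by
      intro a b; rw [map_add]; ring
    simp_rw [this, Finset.sum_add_distrib, ← Finset.mul_sum, hY, cY]
    simp [Finset.mul_sum, mul_left_comm]
  · have : ∀ a b, (X a + Y b) ^ 2 = X a ^ 2 + 2 * X a * Y b + Y b ^ 2 := by
      intro a b; ring
    simp_rw [this, Finset.sum_add_distrib, ← Finset.mul_sum, hY]
    simp [Finset.mul_sum]
  · have : ∀ a b, ((X a + Y b) * conj (X a + Y b)) ^ 2 =
        (X a * conj (X a)) ^ 2 + X a ^ 2 * conj (Y b ^ 2) + 4 * (X a * conj (X a)) * (Y b * conj (Y b))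
        + conj (X a ^ 2) * Y b ^ 2 + (Y b * conj (Y b)) ^ 2
        + 2 * X a ^ 2 * conj (X a) * conj (Y b) + 2 * X a * conj (X a) ^ 2 * Y b
        + X a * (2 * Y b * conj (Y b) ^ 2) + conj (X a) * (2 * Y b ^ 2 * conj (Y b)) := by
      intro a b; simp only [map_add, map_pow]; ring
    simp_rw [this, Finset.sum_add_distrib, ← Finset.mul_sum, ← Finset.sum_mul, hY, cY, hX, cX, map_sum,
      ← Finset.mul_sum]
    simp [Finset.mul_sum]

lemma moments {A : Type*} [Fintype A] (g : A → ℂ) (hg : ∑ a, g a = 0) (n : ℕ) (w : Fin n → ℂ)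
    (hw : ∀ j, w j * conj (w j) = 1) :
    (∑ v : Fin n → A, (∑ j, w j * g (v j)) = 0) ∧
    (∑ v : Fin n → A, (∑ j, w j * g (v j)) * conj (∑ j, w j * g (v j))) * Fintype.card A
      = (Fintype.card A : ℂ) ^ n * (n * ∑ a, g a * conj (g a)) ∧
    (∑ v : Fin n → A, (∑ j, w j * g (v j)) ^ 2) * Fintype.card A
      = (Fintype.card A : ℂ) ^ n * ((∑ j, w j ^ 2) * ∑ a, g a ^ 2) ∧
    (∑ v : Fin n → A, ((∑ j, w j * g (v j)) * conj (∑ j, w j * g (v j))) ^ 2) * (Fintype.card A) ^ 2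
      = (Fintype.card A : ℂ) ^ n * (n * (∑ a, (g a * conj (g a)) ^ 2) * Fintype.card A
         + 2 * n * (n - 1) * (∑ a, g a * conj (g a)) ^ 2
         + (∑ a, g a ^ 2) * conj (∑ a, g a ^ 2) * ((∑ j, w j ^ 2) * conj (∑ j, w j ^ 2) - n)) := by
  induction n with
  | zero => simp
  | succ n ih =>
    obtain ⟨i1, i2, i3, i4⟩ := ih (fun j => w j.succ) (fun j => hw _)
    have key : ∀ Φ : ℂ → ℂ, ∑ v : Fin (n+1) → A, Φ (∑ j, w j * g (v j))
      = ∑ a : A, ∑ v : Fin n → A, Φ (w 0 * g a + ∑ j, w j.succ * g (v j)) := by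
      intro Φ
      rw [← (Fin.consEquiv (fun _ => A)).sum_comp, Fintype.sum_prod_type]
      simp [Fin.consEquiv, Fin.sum_univ_succ]
    rw [key (fun z => z), key (fun z => z * conj z), key (fun z => z ^ 2), key (fun z => (z * conj z)^2)]
    simp only [Fin.sum_univ_succ (fun j => w j ^ 2)]
    obtain ⟨t1, t2, t3, t4⟩ := two_moments (fun a => w 0 * g a)
      (fun v : Fin n → A => ∑ j, w j.succ * g (v j)) (by rw [← Finset.mul_sum, hg, mul_zero]) i1
    rw [t1, t2, t3, t4]
    set S : (Fin n → A) → ℂ := fun v => ∑ j, w j.succ * g (v j) with hS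
    have i3' := congrArg conj i3
    have hw0 := hw 0
    have e1 : ∑ a, w 0 * g a * conj (w 0 * g a) = ∑ a, g a * conj (g a) := by
      refine Finset.sum_congr rfl fun a _ => ?_
      rw [map_mul]; linear_combination (g a * conj (g a)) * hw0
    have e2 : ∑ a, (w 0 * g a * conj (w 0 * g a)) ^ 2 = ∑ a, (g a * conj (g a)) ^ 2 := by
      refine Finset.sum_congr rfl fun a _ => ?_
      rw [map_mul]; linear_combination (g a * conj (g a)) ^ 2 * (w 0 * conj (w 0) + 1) * hw0
    have e3 : ∑ a, (w 0 * g a) ^ 2 = w 0 ^ 2 * ∑ a, g a ^ 2 := by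
      simp_rw [mul_pow, Finset.mul_sum]
    rw [e1, e2, e3]
    simp only [map_mul, map_add, map_pow, map_natCast] at i3' ⊢
    have hcard : ((Fintype.card (Fin n → A) : ℕ) : ℂ) = (Fintype.card A : ℂ) ^ n := by simp
    rw [hcard]
    set M : ℂ := (Fintype.card A : ℂ) with hM
    set W := ∑ j : Fin n, w j.succ ^ 2
    set p2 := ∑ a, g a * conj (g a)
    set p4 := ∑ a, (g a * conj (g a)) ^ 2
    set e := ∑ a, g a ^ 2
    set s1 := ∑ v, S v ^ 2
    set s2 := ∑ v, S v * conj (S v)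
    set s4 := ∑ v, (S v * conj (S v)) ^ 2
    push_cast
    refine ⟨trivial, ?_, ?_, ?_⟩
    · linear_combination M * i2
    · linear_combination M * i3
    · linear_combination M * i4 + 4 * M * p2 * i2 + M * w 0 ^ 2 * e * i3' + M * conj (w 0) ^ 2 * conj e * i3
        - M ^ (n + 1) * e * conj e * (w 0 * conj (w 0) + 1) * hw0

/-- correlation sum -/
noncomputable def corS {h : ℕ} [NeZero h] (f : ZMod h → ℂ) (t : ZMod h) : ℂ :=
  ∑ x, f (x + t) * conj (f x)

lemma cross_bound {h : ℕ} [NeZero h] (f : ZMod h → ℂ) (n : ZMod h) :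
    ∑ t : ZMod h, ‖∑ x, (f (x + t) * conj (f x)) * ZMod.stdAddChar (n * x)‖ ^ 2 ≤ ∑ t, ‖corS f t‖ ^ 2 := by
  have hpos : (0 : ℝ) < h := by exact_mod_cast NeZero.pos h
  refine le_of_mul_le_mul_left ?_ hpos
  have h1 := parseval_cross f (fun x => f x * ZMod.stdAddChar (-(n * x)))
  have h2 := parseval_cross f f
  have h3 : ∀ t x, f (x + t) * conj (f x * ZMod.stdAddChar (-(n * x))) = (f (x + t) * conj (f x)) * ZMod.stdAddChar (n * x) := by
    intro t x
    rw [map_mul, ← AddChar.map_neg_eq_conj, neg_neg]; ring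
  simp_rw [h3] at h1
  unfold corS
  rw [← h1, ← h2]
  set F : ZMod h → ℂ := fun m => ∑ x, f x * ZMod.stdAddChar (m * x) with hF
  have h4 : ∀ m, ∑ x, f x * ZMod.stdAddChar (-(n * x)) * ZMod.stdAddChar (m * x) = F (m - n) := by
    intro m
    refine Finset.sum_congr rfl fun x _ => ?_
    rw [mul_assoc, ← AddChar.map_add_eq_mul]; congr 2; ring
  simp_rw [h4]
  have h5 : ∑ m, ‖F (m - n)‖ ^ 2 * ‖F (m - n)‖ ^ 2 = ∑ m, ‖F m‖ ^ 2 * ‖F m‖ ^ 2 :=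
    Equiv.sum_comp (Equiv.subRight n) (fun m => ‖F m‖ ^ 2 * ‖F m‖ ^ 2)
  have h6 : ∑ m, ‖F m‖ ^ 2 * ‖F (m - n)‖ ^ 2 ≤ ∑ m, (‖F m‖ ^ 2 * ‖F m‖ ^ 2 + ‖F (m - n)‖ ^ 2 * ‖F (m - n)‖ ^ 2) / 2 := by
    refine Finset.sum_le_sum fun m _ => ?_
    nlinarith [sq_nonneg (‖F m‖ ^ 2 - ‖F (m - n)‖ ^ 2)]
  rw [← Finset.sum_div, Finset.sum_add_distrib, h5] at h6
  linarith

lemma window_parseval {h : ℕ} [NeZero h] (u : ZMod h → ℂ) (s : Finset ℕ) :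
    h * ∑ a, ‖∑ l ∈ s, u (l + a)‖ ^ 2
      = ∑ n, ‖∑ x, u x * ZMod.stdAddChar (n * x)‖ ^ 2 * ‖∑ l ∈ s, ZMod.stdAddChar (n * (l : ZMod h))‖ ^ 2 := by
  rw [← orth Finset.univ _ id Function.injective_id.injOn]
  refine Finset.sum_congr rfl fun n _ => ?_
  rw [← mul_pow, ← RCLike.norm_conj (∑ l ∈ s, ZMod.stdAddChar (n * (l : ZMod h))), ← norm_mul]
  congr 2
  simp_rw [map_sum, Finset.sum_mul, Finset.mul_sum]
  rw [Finset.sum_comm]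
  conv_rhs => rw [Finset.sum_comm]
  refine Finset.sum_congr rfl fun l _ => ?_
  rw [← Equiv.sum_comp (Equiv.addLeft (l : ZMod h)) (fun x => u x * ZMod.stdAddChar (n * x) * conj (ZMod.stdAddChar (n * (l : ZMod h))))]
  refine Finset.sum_congr rfl fun x _ => ?_
  simp only [Equiv.coe_addLeft, id]
  rw [← AddChar.map_neg_eq_conj, mul_assoc, ← AddChar.map_add_eq_mul]; congr 2; ring

lemma cast_injOn {h : ℕ} {s : ℕ} (hs : s ≤ h) : Set.InjOn (fun l : ℕ => (l : ZMod h)) (Finset.range s) := by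
  intro a ha b hb hab
  simp only [Finset.coe_range, Set.mem_Iio] at ha hb
  have := (ZMod.natCast_eq_natCast_iff' a b h).1 hab
  rwa [Nat.mod_eq_of_lt (by omega), Nat.mod_eq_of_lt (by omega)] at this

lemma sum_range_cast {h : ℕ} [NeZero h] {β : Type*} [AddCommMonoid β] (φ : ZMod h → β) :
    ∑ l ∈ Finset.range h, φ (l : ZMod h) = ∑ x, φ x := by
  refine Finset.sum_nbij' (fun l => (l : ZMod h)) (fun x => x.val) ?_ ?_ ?_ ?_ ?_
  · simp
  · intro x _; simpa using ZMod.val_lt x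
  · intro a ha; simp only [Finset.mem_range] at ha; exact ZMod.val_cast_of_lt ha
  · intro x _; simp
  · simp

/-- window character sum -/
noncomputable def kap {h : ℕ} [NeZero h] (n : ZMod h) : ℝ := (‖1 - (ZMod.stdAddChar n : ℂ)‖ ^ 2)⁻¹

lemma psi_ne_one {h : ℕ} [NeZero h] {n : ZMod h} (hn : n ≠ 0) : (ZMod.stdAddChar n : ℂ) ≠ 1 := by
  intro H
  apply hn
  apply ZMod.injective_stdAddChar
  rw [H, AddChar.map_zero_eq_one]

lemma geomW {h : ℕ} [NeZero h] {n : ZMod h} (hn : n ≠ 0) (L : ℕ) :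
    ‖∑ l ∈ Finset.range L, (ZMod.stdAddChar (n * (l : ZMod h)) : ℂ)‖ ^ 2
      = ‖1 - (ZMod.stdAddChar (n * (L : ZMod h)) : ℂ)‖ ^ 2 * kap n := by
  have h1 : ∀ l : ℕ, (ZMod.stdAddChar (n * (l : ZMod h)) : ℂ) = ZMod.stdAddChar n ^ l := by
    intro l
    rw [← AddChar.map_nsmul_eq_pow, nsmul_eq_mul, mul_comm]
  simp_rw [h1]
  rw [geom_sum_eq (psi_ne_one hn), norm_div, div_pow, kap, div_eq_mul_inv,
    norm_sub_rev, norm_sub_rev _ (1 : ℂ)]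

lemma kap_nonneg {h : ℕ} [NeZero h] (n : ZMod h) : 0 ≤ kap n := by unfold kap; positivity

lemma geomW_le {h : ℕ} [NeZero h] {n : ZMod h} (hn : n ≠ 0) (L : ℕ) :
    ‖∑ l ∈ Finset.range L, (ZMod.stdAddChar (n * (l : ZMod h)) : ℂ)‖ ^ 2 ≤ 4 * kap n := by
  rw [geomW hn]
  refine mul_le_mul_of_nonneg_right ?_ (kap_nonneg n)
  have : ‖1 - (ZMod.stdAddChar (n * (L : ZMod h)) : ℂ)‖ ≤ 2 := by
    refine (norm_sub_le _ _).trans ?_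
    rw [AddChar.norm_apply]; norm_num
  nlinarith [norm_nonneg (1 - (ZMod.stdAddChar (n * (L : ZMod h)) : ℂ))]

lemma sum_char_zero {h : ℕ} [NeZero h] {n : ZMod h} (hn : n ≠ 0) :
    ∑ x : ZMod h, (ZMod.stdAddChar (n * x) : ℂ) = 0 := by
  have := AddChar.sum_mulShift n (ZMod.isPrimitive_stdAddChar h)
  rw [if_neg hn] at this
  simpa [mul_comm] using this

lemma sum_one_sub {h : ℕ} [NeZero h] {n : ZMod h} (hn : n ≠ 0) :
    ∑ x : ZMod h, ‖1 - (ZMod.stdAddChar (n * x) : ℂ)‖ ^ 2 = 2 * h := by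
  have h1 : ∀ x : ZMod h, ‖1 - (ZMod.stdAddChar (n * x) : ℂ)‖ ^ 2 = 2 - 2 * (ZMod.stdAddChar (n * x) : ℂ).re := by
    intro x
    have h2 : ‖(ZMod.stdAddChar (n * x) : ℂ)‖ ^ 2 = 1 := by rw [AddChar.norm_apply]; norm_num
    rw [← Complex.normSq_eq_norm_sq, Complex.normSq_apply] at h2 ⊢
    simp only [Complex.sub_re, Complex.sub_im, Complex.one_re, Complex.one_im]
    linarith
  simp_rw [h1]
  rw [Finset.sum_sub_distrib, ← Finset.mul_sum, ← Complex.re_sum, sum_char_zero hn]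
  simp [ZMod.card, mul_comm]

lemma sum_kap {h : ℕ} [NeZero h] : 8 * ∑ n ∈ Finset.univ.erase (0 : ZMod h), kap n ≤ (h : ℝ) ^ 2 := by
  have hpos : (0 : ℝ) < h := by exact_mod_cast NeZero.pos h
  have h1 : ∀ n ∈ Finset.univ.erase (0 : ZMod h),
      ∑ s ∈ Finset.range h, ‖∑ l ∈ Finset.range s, (ZMod.stdAddChar (n * (l : ZMod h)) : ℂ)‖ ^ 2 = 2 * h * kap n := by
    intro n hn
    have hn := Finset.ne_of_mem_erase hn
    simp_rw [geomW hn, ← Finset.sum_mul]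
    rw [sum_range_cast (fun x => ‖1 - (ZMod.stdAddChar (n * x) : ℂ)‖ ^ 2), sum_one_sub hn]
  have h2 : ∀ s ∈ Finset.range h, ∑ n ∈ Finset.univ.erase (0 : ZMod h),
      ‖∑ l ∈ Finset.range s, (ZMod.stdAddChar (n * (l : ZMod h)) : ℂ)‖ ^ 2 ≤ (h : ℝ) ^ 2 / 4 := by
    intro s hs
    have h3 := orth (N := h) (Finset.range s) (fun _ => 1) (fun l => (l : ZMod h))
      (cast_injOn (Finset.mem_range.1 hs).le)
    rw [← Finset.add_sum_erase _ _ (Finset.mem_univ (0 : ZMod h))] at h3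
    have h0 : ‖∑ l ∈ Finset.range s, (1 : ℂ) * ZMod.stdAddChar ((0 : ZMod h) * (l : ZMod h))‖ ^ 2 = (s : ℝ) ^ 2 := by
      simp
    have h0' : ∑ l ∈ Finset.range s, ‖(1 : ℂ)‖ ^ 2 = (s : ℝ) := by simp
    rw [h0, h0'] at h3
    simp only [one_mul] at h3
    nlinarith [sq_nonneg ((h : ℝ) - 2 * s)]
  have h4 := Finset.sum_le_sum h2
  rw [Finset.sum_comm, Finset.sum_congr rfl h1, ← Finset.mul_sum] at h4
  rw [Finset.sum_const, Finset.card_range, nsmul_eq_mul] at h4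
  nlinarith

/-- windows -/
noncomputable def cw {h : ℕ} [NeZero h] (f : ZMod h → ℂ) (t : ℕ) (a : ZMod h) : ℂ :=
  ∑ l ∈ Finset.range (h - t), f (l + a + t) * conj (f (l + a))

/-- complementary windows -/
noncomputable def dw {h : ℕ} [NeZero h] (f : ZMod h → ℂ) (t : ℕ) (a : ZMod h) : ℂ :=
  ∑ l ∈ Finset.Ico (h - t) h, f (l + a + t) * conj (f (l + a))

lemma window_t {h : ℕ} [NeZero h] (f : ZMod h → ℂ) (t : ℕ) (ht : t < h) :
    h * ∑ a, (‖cw f t a‖ ^ 2 + ‖dw f t a‖ ^ 2) ≤ h ^ 2 * ‖corS f t‖ ^ 2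
      + 8 * ∑ n ∈ Finset.univ.erase (0 : ZMod h), kap n *
        ‖∑ x, (f (x + t) * conj (f x)) * ZMod.stdAddChar (n * x)‖ ^ 2 := by
  have h1 := window_parseval (fun x : ZMod h => f (x + t) * conj (f x)) (Finset.range (h - t))
  have h2 := window_parseval (fun x : ZMod h => f (x + t) * conj (f x)) (Finset.Ico (h - t) h)
  rw [Finset.sum_add_distrib, mul_add]
  unfold cw dw
  rw [h1, h2, ← Finset.sum_add_distrib, ← Finset.add_sum_erase _ _ (Finset.mem_univ (0 : ZMod h)),
    Finset.mul_sum]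
  refine add_le_add ?_ (Finset.sum_le_sum fun n hn => ?_)
  · have h3 : ((h - t : ℕ) : ℝ) = h - t := by push_cast [ht.le]; ring
    have h4 : ((h - (h - t) : ℕ) : ℝ) = t := by congr 1; omega
    have h5 : (t : ℝ) < h := by exact_mod_cast ht
    have h6 : (0 : ℝ) ≤ t := by positivity
    have k1 : ‖∑ l ∈ Finset.range (h - t), (ZMod.stdAddChar ((0 : ZMod h) * (l : ZMod h)) : ℂ)‖ = h - t := by
      simp_rw [zero_mul, AddChar.map_zero_eq_one]
      rw [Finset.sum_const, Finset.card_range, nsmul_eq_mul, mul_one, Complex.norm_natCast, h3]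
    have k2 : ‖∑ l ∈ Finset.Ico (h - t) h, (ZMod.stdAddChar ((0 : ZMod h) * (l : ZMod h)) : ℂ)‖ = t := by
      simp_rw [zero_mul, AddChar.map_zero_eq_one]
      rw [Finset.sum_const, Nat.card_Ico, nsmul_eq_mul, mul_one, Complex.norm_natCast, h4]
    have k3 : ∑ x : ZMod h, (f (x + t) * conj (f x)) * ZMod.stdAddChar ((0 : ZMod h) * x) = corS f t := by
      simp [corS]
    rw [k1, k2, k3]
    have := sq_nonneg ‖corS f t‖
    have h7 : ((h : ℝ) - t) ^ 2 + t ^ 2 ≤ h ^ 2 := by nlinarith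
    nlinarith
  · have hn := Finset.ne_of_mem_erase hn
    have h7 := geomW_le hn (h - t)
    have h8 : ‖∑ l ∈ Finset.Ico (h - t) h, (ZMod.stdAddChar (n * (l : ZMod h)) : ℂ)‖ =
       ‖∑ l ∈ Finset.range (h - t), (ZMod.stdAddChar (n * (l : ZMod h)) : ℂ)‖ := by
      rw [Finset.sum_Ico_eq_sub _ (Nat.sub_le h t), sum_range_cast (fun x => (ZMod.stdAddChar (n * x) : ℂ)),
        sum_char_zero hn, zero_sub, norm_neg]
    rw [h8]
    have := sq_nonneg ‖∑ x, (f (x + t) * conj (f x)) * ZMod.stdAddChar (n * x)‖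
    nlinarith

lemma window_total {h : ℕ} [NeZero h] (f : ZMod h → ℂ) :
    ∑ a, ∑ t ∈ Finset.range h, (‖cw f t a‖ ^ 2 + ‖dw f t a‖ ^ 2) ≤ 2 * h * ∑ t, ‖corS f t‖ ^ 2 := by
  have hpos : (0 : ℝ) < h := by exact_mod_cast NeZero.pos h
  refine le_of_mul_le_mul_left ?_ hpos
  rw [Finset.sum_comm, Finset.mul_sum]
  refine (Finset.sum_le_sum fun t ht => window_t f t (Finset.mem_range.1 ht)).trans ?_
  rw [Finset.sum_add_distrib, ← Finset.mul_sum, ← Finset.mul_sum, Finset.sum_comm,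
    sum_range_cast (fun t => ‖corS f t‖ ^ 2)]
  have hS : 0 ≤ ∑ t, ‖corS f t‖ ^ 2 := by positivity
  have h1 : ∑ n ∈ Finset.univ.erase (0 : ZMod h), ∑ t ∈ Finset.range h, kap n *
        ‖∑ x, (f (x + t) * conj (f x)) * ZMod.stdAddChar (n * x)‖ ^ 2
        ≤ ∑ n ∈ Finset.univ.erase (0 : ZMod h), kap n * ∑ t, ‖corS f t‖ ^ 2 := by
    refine Finset.sum_le_sum fun n hn => ?_
    rw [← Finset.mul_sum, sum_range_cast (fun t => ‖∑ x, (f (x + t) * conj (f x)) * ZMod.stdAddChar (n * x)‖ ^ 2)]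
    exact mul_le_mul_of_nonneg_left (cross_bound f n) (kap_nonneg n)
  rw [← Finset.sum_mul] at h1
  have h2 := mul_le_mul_of_nonneg_right (sum_kap (h := h)) hS
  nlinarith

/-- block transform -/
noncomputable def gm {h H : ℕ} [NeZero h] [NeZero H] (f : ZMod h → ℂ) (m : ZMod H) (a : ZMod h) : ℂ :=
  ∑ k ∈ Finset.range h, f (k + a) * ZMod.stdAddChar (m * (k : ZMod H))

lemma gm_normSq {h H : ℕ} [NeZero h] [NeZero H] (f : ZMod h → ℂ) (m : ZMod H) (a : ZMod h) :
    gm f m a * conj (gm f m a) = ∑ t ∈ Finset.range h, (cw f t a * ZMod.stdAddChar (m * (t : ZMod H))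
      + dw f t a * ZMod.stdAddChar (m * ((t : ZMod H) - (h : ZMod H)))) := by
  have hpos : 0 < h := NeZero.pos h
  have e1 : gm f m a * conj (gm f m a) = ∑ l ∈ Finset.range h, ∑ t ∈ Finset.range h,
      f (l + a + t) * conj (f (l + a)) *
        (if l < h - t then ZMod.stdAddChar (m * (t : ZMod H))
          else ZMod.stdAddChar (m * ((t : ZMod H) - (h : ZMod H)))) := by
    unfold gm
    rw [map_sum, Finset.sum_mul_sum, Finset.sum_comm]
    refine Finset.sum_congr rfl fun l hl => ?_
    have hl := Finset.mem_range.1 hl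
    symm
    refine Finset.sum_nbij' (fun t => if l < h - t then l + t else l + t - h)
      (fun k => if l ≤ k then k - l else k + h - l) ?_ ?_ ?_ ?_ ?_
    · intro t ht
      have ht := Finset.mem_range.1 ht
      simp only [Finset.mem_range]
      split_ifs <;> omega
    · intro t ht
      have ht := Finset.mem_range.1 ht
      simp only [Finset.mem_range]
      split_ifs <;> omega
    · intro t ht
      have ht := Finset.mem_range.1 ht
      split_ifs <;> omega
    · intro t ht
      have ht := Finset.mem_range.1 ht
      split_ifs <;> omega
    · intro t ht
      have ht := Finset.mem_range.1 ht
      rw [map_mul (starRingEnd ℂ), ← AddChar.map_neg_eq_conj, mul_mul_mul_comm, ← AddChar.map_add_eq_mul]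
      split_ifs with hc
      · congr 2
        · congr 1; push_cast; ring_nf
        · push_cast; ring
      · have hle : h ≤ l + t := by omega
        congr 2
        · congr 1; rw [Nat.cast_sub hle]; push_cast; rw [ZMod.natCast_self]; ring_nf
        · rw [Nat.cast_sub hle]; push_cast; ring
  rw [e1, Finset.sum_comm]
  refine Finset.sum_congr rfl fun t ht => ?_
  rw [← Finset.sum_range_add_sum_Ico _ (Nat.sub_le h t)]
  unfold cw dw
  rw [Finset.sum_mul, Finset.sum_mul]
  congr 1
  · refine Finset.sum_congr rfl fun l hl => ?_
    rw [if_pos (Finset.mem_range.1 hl)]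
  · refine Finset.sum_congr rfl fun l hl => ?_
    rw [if_neg (not_lt.2 (Finset.mem_Ico.1 hl).1)]

lemma orth2 {h H : ℕ} [NeZero H] (hH : 2 * h ≤ H) (c d : ℕ → ℂ) :
    ∑ m : ZMod H, ‖∑ t ∈ Finset.range h, (c t * ZMod.stdAddChar (m * (t : ZMod H))
      + d t * ZMod.stdAddChar (m * ((t : ZMod H) - (h : ZMod H))))‖ ^ 2
      = H * ∑ t ∈ Finset.range h, (‖c t‖ ^ 2 + ‖d t‖ ^ 2) := by
  have := orth (N := H) (Finset.range h ×ˢ (Finset.univ : Finset Bool))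
    (fun i => if i.2 then c i.1 else d i.1)
    (fun i => if i.2 then (i.1 : ZMod H) else (i.1 : ZMod H) - (h : ZMod H)) ?_
  · simpa [Finset.sum_product] using this
  · rintro ⟨a, x⟩ ha ⟨b, y⟩ hb hab
    simp at ha hb
    have key : ∀ u v : ℕ, u < 2 * h → v < 2 * h → (u : ZMod H) = v → u = v := by
      intro u v hu hv huv
      exact cast_injOn hH (by simpa using hu) (by simpa using hv) huv
    cases x <;> cases y <;> simp at hab ⊢
    · exact key a b (by omega) (by omega) hab
    · have := key a (b + h) (by omega) (by omega) (by push_cast; rw [← hab]; ring)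
      omega
    · have := key (a + h) b (by omega) (by omega) (by push_cast; rw [hab]; ring)
      omega
    · exact key a b (by omega) (by omega) hab

lemma cw_add_dw {h : ℕ} [NeZero h] (f : ZMod h → ℂ) (t : ℕ) (a : ZMod h) :
    cw f t a + dw f t a = corS f t := by
  unfold cw dw corS
  rw [Finset.sum_range_add_sum_Ico _ (Nat.sub_le h t),
    sum_range_cast (fun l => f (l + a + (t : ZMod h)) * conj (f (l + a)))]
  exact Equiv.sum_comp (Equiv.addRight a) (fun l => f (l + (t : ZMod h)) * conj (f l))

lemma sum_shift {h : ℕ} [NeZero h] (f : ZMod h → ℂ) (t : ℕ) (s : Finset ℕ) :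
    ∑ a, ∑ l ∈ s, f (l + a + t) * conj (f (l + a)) = s.card * corS f t := by
  rw [Finset.sum_comm, Finset.sum_congr rfl (g := fun _ => corS f t)]
  · simp
  · intro l _
    exact Equiv.sum_comp (Equiv.addLeft (l : ZMod h)) (fun l => f (l + t) * conj (f l))

lemma four_eq (z : ℂ) : ‖z‖ ^ 4 = ‖z * conj z‖ ^ 2 := by
  rw [norm_mul, RCLike.norm_conj]; ring

lemma bound_ii {h H : ℕ} [NeZero h] [NeZero H] (hH : 2 * h ≤ H) (f : ZMod h → ℂ) :
    ∑ m : ZMod H, ∑ a, ‖gm f m a‖ ^ 4 ≤ 2 * h * H * ∑ t, ‖corS f t‖ ^ 2 := by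
  rw [Finset.sum_comm]
  simp_rw [four_eq, gm_normSq, orth2 hH, ← Finset.mul_sum]
  have := mul_le_mul_of_nonneg_left (window_total f) (Nat.cast_nonneg (α := ℝ) H)
  linarith

lemma bound_i {h H : ℕ} [NeZero h] [NeZero H] (hH : 2 * h ≤ H) (f : ZMod h → ℂ) :
    ∑ m : ZMod H, (∑ a, ‖gm f m a‖ ^ 2) ^ 2 ≤ h ^ 2 * H * ∑ t, ‖corS f t‖ ^ 2 := by
  have e1 : ∀ m : ZMod H, (∑ a, ‖gm f m a‖ ^ 2) ^ 2 = ‖∑ a, gm f m a * conj (gm f m a)‖ ^ 2 := by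
    intro m
    simp_rw [Complex.mul_conj']
    rw [← Complex.norm_of_nonneg (r := ∑ a, ‖gm f m a‖ ^ 2) (by positivity)]
    push_cast; rfl
  simp_rw [e1, gm_normSq]
  have e2 : ∀ m : ZMod H, ∑ a, ∑ t ∈ Finset.range h, (cw f t a * ZMod.stdAddChar (m * (t : ZMod H))
      + dw f t a * ZMod.stdAddChar (m * ((t : ZMod H) - (h : ZMod H))))
      = ∑ t ∈ Finset.range h, ((∑ a, cw f t a) * ZMod.stdAddChar (m * (t : ZMod H))
      + (∑ a, dw f t a) * ZMod.stdAddChar (m * ((t : ZMod H) - (h : ZMod H)))) := by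
    intro m
    rw [Finset.sum_comm]
    simp_rw [Finset.sum_add_distrib, Finset.sum_mul]
  simp_rw [e2, orth2 hH]
  have e3 : ∑ t ∈ Finset.range h, (‖∑ a, cw f t a‖ ^ 2 + ‖∑ a, dw f t a‖ ^ 2)
      ≤ ∑ t ∈ Finset.range h, (h : ℝ) ^ 2 * ‖corS f t‖ ^ 2 := by
    refine Finset.sum_le_sum fun t ht => ?_
    have ht := Finset.mem_range.1 ht
    unfold cw dw
    rw [sum_shift, sum_shift, norm_mul, norm_mul, Finset.card_range, Nat.card_Ico,
      Complex.norm_natCast, Complex.norm_natCast]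
    have h3 : ((h - t : ℕ) : ℝ) = h - t := by push_cast [ht.le]; ring
    have h4 : ((h - (h - t) : ℕ) : ℝ) = t := by congr 1; omega
    have h5 : (t : ℝ) < h := by exact_mod_cast ht
    have h6 : (0 : ℝ) ≤ t := by positivity
    rw [h3, h4]
    have := sq_nonneg ‖corS f t‖
    have h7 : ((h : ℝ) - t) ^ 2 + t ^ 2 ≤ h ^ 2 := by nlinarith
    nlinarith
  rw [← Finset.mul_sum, sum_range_cast (fun t => ‖corS f t‖ ^ 2)] at e3
  have := mul_le_mul_of_nonneg_left e3 (Nat.cast_nonneg (α := ℝ) H)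
  linarith

/-- the case `q = 1` -/
lemma bound_one {h H : ℕ} [NeZero h] [NeZero H] (hH : H = h) (f : ZMod h → ℂ) :
    ∑ m : ZMod H, ∑ a, ‖gm f m a‖ ^ 4 = h * H * ∑ t, ‖corS f t‖ ^ 2 := by
  subst hH
  rw [Finset.sum_comm]
  have e : ∀ (m a : ZMod H), gm f m a * conj (gm f m a) = ∑ t, corS f t * ZMod.stdAddChar (m * id t) := by
    intro m a
    rw [gm_normSq, ← sum_range_cast]
    simp [← add_mul, cw_add_dw]
  simp_rw [four_eq, e, orth Finset.univ _ id Function.injective_id.injOn]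
  simp [ZMod.card, mul_assoc]

lemma gm_sum_zero {h H : ℕ} [NeZero h] [NeZero H] (f : ZMod h → ℂ) (hf : ∑ j, f j = 0) (m : ZMod H) :
    ∑ a, gm f m a = 0 := by
  unfold gm
  rw [Finset.sum_comm]
  refine Finset.sum_eq_zero fun k _ => ?_
  have e : ∑ a, f (k + a) = ∑ a, f a := Equiv.sum_comp (Equiv.addLeft (k : ZMod h)) f
  rw [← Finset.sum_mul, e, hf, zero_mul]

lemma gm_shift {h H : ℕ} [NeZero h] [NeZero H] (f : ZMod h → ℂ) (m : ZMod H) 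
    (hm : m * (h : ZMod H) = 0) (a : ZMod h) :
    gm f m (a + 1) * ZMod.stdAddChar m = gm f m a := by
  have e := Finset.sum_range_succ (fun k : ℕ => f (k + a) * ZMod.stdAddChar (m * (k : ZMod H))) h
  rw [Finset.sum_range_succ'] at e
  simp [hm] at e
  unfold gm
  rw [← e, Finset.sum_mul]
  refine Finset.sum_congr rfl fun k _ => ?_
  rw [mul_assoc, ← AddChar.map_add_eq_mul]
  congr 2
  · ring
  · ring

lemma two_mul_zero {H : ℕ} (hodd : Odd H) {x : ZMod H} (hx : 2 * x = 0) : x = 0 := by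
  have : IsUnit (2 : ZMod H) := by
    have := (ZMod.isUnit_iff_coprime 2 H).2 (Nat.coprime_two_left.2 hodd)
    exact_mod_cast this
  exact (this.mul_right_eq_zero).1 hx

lemma special {h q H : ℕ} [NeZero h] [NeZero H] (hH : H = q * h) (hodd : Odd H)
    (f : ZMod h → ℂ) (hf : ∑ j, f j = 0) (m : ZMod H) :
    (∑ a, gm f m a ^ 2) = 0 ∨ ∑ j : Fin q, (ZMod.stdAddChar (m * ((j : ℕ) : ZMod H) * (h : ZMod H)) : ℂ) ^ 2 = 0 := by
  by_cases hm : m * (h : ZMod H) = 0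
  · left
    by_cases hm0 : m = 0
    · have : ∀ a, gm f m a = 0 := by
        intro a
        subst hm0
        unfold gm
        simp only [zero_mul, AddChar.map_zero_eq_one, mul_one]
        rw [sum_range_cast (fun k => f (k + a))]
        exact (Equiv.sum_comp (Equiv.addRight a) f).trans hf
      simp [this]
    · have h1 : ∑ a, gm f m a ^ 2 = (∑ a, gm f m a ^ 2) * ZMod.stdAddChar (2 * m) := by
        conv_lhs => rw [← Finset.sum_congr rfl (fun a _ => congrArg (· ^ 2) (gm_shift f m hm a))]
        simp only [mul_pow, ← Finset.sum_mul]
        have e : ∑ a, gm f m (a + 1) ^ 2 = ∑ a, gm f m a ^ 2 :=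
          Equiv.sum_comp (Equiv.addRight (1 : ZMod h)) (fun a => gm f m a ^ 2)
        rw [e, two_mul, AddChar.map_add_eq_mul, sq]
      by_contra hne
      have h2 := mul_left_cancel₀ hne (h1.symm.trans (mul_one _).symm)
      exact psi_ne_one (fun h => hm0 (two_mul_zero hodd h)) h2
  · right
    have h2 : (ZMod.stdAddChar (2 * (m * (h : ZMod H))) : ℂ) ≠ 1 :=
      psi_ne_one (fun h => hm (two_mul_zero hodd h))
    have h1 : ∀ j : Fin q, (ZMod.stdAddChar (m * ((j : ℕ) : ZMod H) * (h : ZMod H)) : ℂ) ^ 2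
       = (ZMod.stdAddChar (2 * (m * (h : ZMod H))) : ℂ) ^ (j : ℕ) := by
      intro j
      rw [← AddChar.map_nsmul_eq_pow, ← AddChar.map_nsmul_eq_pow, nsmul_eq_mul, nsmul_eq_mul]
      congr 1; push_cast; ring
    simp_rw [h1]
    rw [Fin.sum_univ_eq_sum_range (fun j => (ZMod.stdAddChar (2 * (m * (h : ZMod H))) : ℂ) ^ j) q, geom_sum_eq h2,
      ← AddChar.map_nsmul_eq_pow, nsmul_eq_mul]
    have : (q : ZMod H) * (2 * (m * h)) = 0 := by
      have h3 : ((q * h : ℕ) : ZMod H) = 0 := by rw [← hH]; exact ZMod.natCast_self H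
      push_cast at h3
      linear_combination 2 * m * h3
    rw [this]; simp

lemma fourth_le {h q H : ℕ} [NeZero h] [NeZero H] (hH : H = q * h) (hodd : Odd H)
    (f : ZMod h → ℂ) (hf : ∑ j, f j = 0) (m : ZMod H) :
    (∑ v : Fin q → ZMod h, ‖∑ j : Fin q, ZMod.stdAddChar (m * ((j : ℕ) : ZMod H) * (h : ZMod H)) * gm f m (v j)‖ ^ 4) * h ^ 2
      ≤ (h : ℝ) ^ q * (q * h * (∑ a, ‖gm f m a‖ ^ 4) + 2 * q * (q - 1) * (∑ a, ‖gm f m a‖ ^ 2) ^ 2) := by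
  obtain ⟨-, -, -, h4⟩ := moments (gm f m) (gm_sum_zero f hf m) q
    (fun j => ZMod.stdAddChar (m * ((j : ℕ) : ZMod H) * (h : ZMod H)))
    (by intro j; rw [Complex.mul_conj', AddChar.norm_apply]; simp)
  have e4 : ∀ z : ℂ, (z * conj z) ^ 2 = ((‖z‖ ^ 4 : ℝ) : ℂ) := by
    intro z; rw [Complex.mul_conj']; push_cast; ring
  simp_rw [e4, ZMod.card, Complex.mul_conj'] at h4
  have h5 : (∑ v : Fin q → ZMod h, ‖∑ j : Fin q, ZMod.stdAddChar (m * ((j : ℕ) : ZMod H) * (h : ZMod H)) * gm f m (v j)‖ ^ 4) * h ^ 2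
      = (h : ℝ) ^ q * ((q * ∑ a, ‖gm f m a‖ ^ 4) * h + 2 * q * (q - 1) * (∑ a, ‖gm f m a‖ ^ 2) ^ 2
        + ‖∑ a, gm f m a ^ 2‖ ^ 2 *
      (‖∑ j : Fin q, (ZMod.stdAddChar (m * ((j : ℕ) : ZMod H) * (h : ZMod H)) : ℂ) ^ 2‖ ^ 2 - q)) := by
    apply Complex.ofReal_injective
    push_cast at h4 ⊢
    exact h4
  have hz : ‖∑ a, gm f m a ^ 2‖ ^ 2 *
      (‖∑ j : Fin q, (ZMod.stdAddChar (m * ((j : ℕ) : ZMod H) * (h : ZMod H)) : ℂ) ^ 2‖ ^ 2 - q) ≤ 0 := by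
    rcases special hH hodd f hf m with h0 | h0
    · rw [h0]; simp
    · rw [h0]
      have : (0 : ℝ) ≤ q := by positivity
      have := mul_nonneg (sq_nonneg ‖∑ a, gm f m a ^ 2‖) this
      simp only [norm_zero]
      nlinarith
  rw [h5]
  refine mul_le_mul_of_nonneg_left ?_ (by positivity)
  linarith

lemma dft_comp {h q : ℕ} [NeZero h] [NeZero q] [NeZero (q * h)] (f : ZMod h → ℂ) (α : ZMod q → ZMod h)
    (m : ZMod (q * h)) :
    ∑ x : ZMod (q * h), f (phiMap h q α x) * ZMod.stdAddChar (m * x)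
     = ∑ j : Fin q, ZMod.stdAddChar (m * ((j : ℕ) : ZMod (q * h)) * (h : ZMod (q * h))) *
        gm f m (α ((j : ℕ) : ZMod q)) := by
  have hpos : 0 < h := NeZero.pos h
  rw [← sum_range_cast, Fin.sum_univ_eq_sum_range (fun j => ZMod.stdAddChar (m * (j : ZMod (q * h)) * (h : ZMod (q * h))) *
        gm f m (α (j : ZMod q))) q]
  unfold gm
  simp_rw [Finset.mul_sum]
  rw [← Finset.sum_product']
  symm
  refine Finset.sum_nbij' (fun p => p.1 * h + p.2) (fun n => (n / h, n % h)) ?_ ?_ ?_ ?_ ?_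
  · rintro ⟨j, k⟩ hp
    simp only [Finset.mem_product, Finset.mem_range] at hp ⊢
    nlinarith
  · intro n hn
    simp only [Finset.mem_product, Finset.mem_range] at hn ⊢
    exact ⟨Nat.div_lt_of_lt_mul (by rwa [mul_comm]), Nat.mod_lt _ hpos⟩
  · rintro ⟨j, k⟩ hp
    simp only [Finset.mem_product, Finset.mem_range] at hp
    ext
    · simp [Nat.add_comm, Nat.add_mul_div_right _ _ hpos, Nat.div_eq_of_lt hp.2]
    · simp [Nat.add_comm, Nat.mod_eq_of_lt hp.2]
  · intro n hn
    exact Nat.div_add_mod' n h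
  · rintro ⟨j, k⟩ hp
    simp only [Finset.mem_product, Finset.mem_range] at hp
    have hlt : j * h + k < q * h := by nlinarith
    unfold phiMap
    rw [ZMod.val_cast_of_lt hlt]
    have e1 : (j * h + k) % h = k := by simp [Nat.add_comm, Nat.mod_eq_of_lt hp.2]
    have e2 : (j * h + k) / h = j := by simp [Nat.add_comm, Nat.add_mul_div_right _ _ hpos, Nat.div_eq_of_lt hp.2]
    rw [e1, e2, mul_left_comm, ← AddChar.map_add_eq_mul]
    congr 2; push_cast; ring

/-- natural enumeration -/
def finZ (q : ℕ) [NeZero q] : Fin q ≃ ZMod q where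
  toFun j := ((j : ℕ) : ZMod q)
  invFun x := ⟨x.val, ZMod.val_lt x⟩
  left_inv j := by ext; exact ZMod.val_cast_of_lt j.2
  right_inv x := by simp

/-- Let `h, q` be odd, `f : ℤ/hℤ → ℂ` of zero mean, and `α` uniformly
distributed on `(ℤ/hℤ)^q`.  Then the expected squared `ℓ²`-norm of the cyclic correlation
sequence of `F_α = f ∘ φ_α` at most doubles:
`E_α[ Σ_{t ∈ ℤ/Hℤ} |RC_{F_α}(t)|² ] ≤ 2·Σ_{d ∈ ℤ/hℤ} |RC_f(d)|²`. -/
theorem expectation_l2_cyclicCorr_comp_phiMap_le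
    (h q : ℕ) [NeZero h] [NeZero q] (hodd : Odd h) (qodd : Odd q)
    (f : ZMod h → ℂ) (hf : ∑ j : ZMod h, f j = 0) :
    ((h : ℝ) ^ q)⁻¹ *
        ∑ α : ZMod q → ZMod h,
          ∑ t : ZMod (q * h),
            ‖cyclicCorr (q * h) (fun x => f (phiMap h q α x)) t‖ ^ 2
      ≤ 2 * ∑ d : ZMod h, ‖cyclicCorr h f d‖ ^ 2 := by
  have hpos : (0 : ℝ) < h := by exact_mod_cast NeZero.pos h
  have qpos : (0 : ℝ) < q := by exact_mod_cast NeZero.pos q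
  set S := ∑ t, ‖corS f t‖ ^ 2 with hS
  have hS0 : 0 ≤ S := by positivity
  have hc : ∀ (N : ℕ) [NeZero N] (g : ZMod N → ℂ),
      ∑ t, ‖cyclicCorr N g t‖ ^ 2 = ((N : ℝ) ^ 2)⁻¹ * ∑ t, ‖corS g t‖ ^ 2 := by
    intro N _ g
    rw [Finset.mul_sum]
    refine Finset.sum_congr rfl fun t _ => ?_
    unfold cyclicCorr corS
    rw [norm_mul, mul_pow, norm_inv, Complex.norm_natCast, inv_pow]
  have hp : ∀ (α : ZMod q → ZMod h), ((q * h : ℕ) : ℝ) * ∑ t, ‖corS (fun x : ZMod (q * h) => f (phiMap h q α x)) t‖ ^ 2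
      = ∑ m : ZMod (q * h), ‖∑ j : Fin q, ZMod.stdAddChar (m * ((j : ℕ) : ZMod (q * h)) * (h : ZMod (q * h))) *
        gm f m (α ((j : ℕ) : ZMod q))‖ ^ 4 := by
    intro α
    have := parseval_cross (fun x : ZMod (q * h) => f (phiMap h q α x)) (fun x : ZMod (q * h) => f (phiMap h q α x))
    unfold corS
    rw [← this]
    refine Finset.sum_congr rfl fun m _ => ?_
    rw [dft_comp]; ring
  have hT : (∑ α : ZMod q → ZMod h, ∑ m : ZMod (q * h),
      ‖∑ j : Fin q, ZMod.stdAddChar (m * ((j : ℕ) : ZMod (q * h)) * (h : ZMod (q * h))) *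
        gm f m (α ((j : ℕ) : ZMod q))‖ ^ 4) * (h : ℝ) ^ 2 ≤
        (h : ℝ) ^ q * (2 * q ^ 2 * h ^ 2 * (q * h) * S) := by
    rw [Finset.sum_comm, Finset.sum_mul]
    have hm : ∀ m : ZMod (q * h), ∑ α : ZMod q → ZMod h,
      ‖∑ j : Fin q, ZMod.stdAddChar (m * ((j : ℕ) : ZMod (q * h)) * (h : ZMod (q * h))) *
        gm f m (α ((j : ℕ) : ZMod q))‖ ^ 4 = ∑ v : Fin q → ZMod h,
      ‖∑ j : Fin q, ZMod.stdAddChar (m * ((j : ℕ) : ZMod (q * h)) * (h : ZMod (q * h))) *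
        gm f m (v j)‖ ^ 4 := by
      intro m
      exact Equiv.sum_comp (Equiv.arrowCongr (finZ q).symm (Equiv.refl (ZMod h))) (fun v : Fin q → ZMod h =>
        ‖∑ j : Fin q, ZMod.stdAddChar (m * ((j : ℕ) : ZMod (q * h)) * (h : ZMod (q * h))) *
        gm f m (v j)‖ ^ 4)
    simp_rw [hm]
    refine (Finset.sum_le_sum fun m _ => fourth_le rfl (qodd.mul hodd) f hf m).trans ?_
    rw [← Finset.mul_sum, Finset.sum_add_distrib, ← Finset.mul_sum, ← Finset.mul_sum]
    refine mul_le_mul_of_nonneg_left ?_ (by positivity)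
    by_cases hq : q = 1
    · have b1 := bound_one (H := q * h) (by rw [hq, one_mul]) f
      rw [b1, ← hS]
      have hq' : (q : ℝ) = 1 := by exact_mod_cast hq
      push_cast
      rw [hq']
      have : 0 ≤ (h : ℝ) ^ 3 * S := by positivity
      nlinarith
    · have hq2 : 2 ≤ q := by have := NeZero.pos q; omega
      have hH : 2 * h ≤ q * h := Nat.mul_le_mul_right h hq2
      have b1 := bound_i hH f
      have b2 := bound_ii hH f
      rw [← hS] at b1 b2
      push_cast at b1 b2
      have hq1 : (0 : ℝ) ≤ 2 * q * (q - 1) := by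
        have : (2 : ℝ) ≤ q := by exact_mod_cast hq2
        nlinarith
      have c1 := mul_le_mul_of_nonneg_left b1 hq1
      have c2 := mul_le_mul_of_nonneg_left b2 (by positivity : (0 : ℝ) ≤ q * h)
      refine (add_le_add c2 c1).trans (le_of_eq ?_)
      ring
  simp_rw [hc]
  have hp' : ∀ (α : ZMod q → ZMod h), ∑ t, ‖corS (fun x : ZMod (q * h) => f (phiMap h q α x)) t‖ ^ 2
      = ((q * h : ℕ) : ℝ)⁻¹ * ∑ m : ZMod (q * h), ‖∑ j : Fin q, ZMod.stdAddChar (m * ((j : ℕ) : ZMod (q * h)) * (h : ZMod (q * h))) *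
        gm f m (α ((j : ℕ) : ZMod q))‖ ^ 4 := by
    intro α
    rw [← hp, inv_mul_cancel_left₀]
    push_cast; positivity
  simp_rw [hp', ← Finset.mul_sum]
  rw [← hS]
  set T := ∑ α : ZMod q → ZMod h, ∑ m : ZMod (q * h),
      ‖∑ j : Fin q, ZMod.stdAddChar (m * ((j : ℕ) : ZMod (q * h)) * (h : ZMod (q * h))) *
        gm f m (α ((j : ℕ) : ZMod q))‖ ^ 4
  have hT' : T ≤ (h : ℝ) ^ q * (2 * q ^ 2 * (q * h) * S) := by
    refine le_of_mul_le_mul_right (hT.trans (le_of_eq ?_)) (by positivity : (0 : ℝ) < h ^ 2)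
    ring
  push_cast
  calc ((h : ℝ) ^ q)⁻¹ * (((q * h : ℝ) ^ 2)⁻¹ * ((q * h : ℝ)⁻¹ * T))
      ≤ ((h : ℝ) ^ q)⁻¹ * (((q * h : ℝ) ^ 2)⁻¹ * ((q * h : ℝ)⁻¹ * ((h : ℝ) ^ q * (2 * q ^ 2 * (q * h) * S)))) := by
        gcongr
    _ = 2 * (((h : ℝ) ^ 2)⁻¹ * S) := by
        field_simp
end
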